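/- arXiv:2504.07504 — 2 statements merged into one kernel-verified Lean document; each statement's English description precedes it below -/
import Mathlib

section
/- Let R be a nontrivial commutative local ring with maximal ideal 𝔪 and residue field k = R/𝔪. Let A and B be finite free R-modules, and let f : A → B and g : B → A be R-linear maps. Let f̄ : A/𝔪A → B/𝔪B and ḡ : B/𝔪B → A/𝔪A denote the induced k-linear maps. If f̄ is surjective, ḡ is injective, and the composite f̄ ∘ ḡ is a nilpotent endomorphism of B/𝔪B, then either A = 0 and B = 0, or rank_R(A) > rank_R(B). -/
/-- The lemma in §6 of the paper: if `R` is a local ring with maximal ideal `𝔪`, `A`, `B` are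
finite free `R`-modules, `f : A → B` and `g : B → A` are linear maps whose reductions `f̄`, `ḡ`
modulo `𝔪` satisfy: `f̄` surjective, `ḡ` injective and `f̄ ∘ ḡ` nilpotent, then either `A` and `B`
are both zero, or `rank A > rank B`. -/
theorem stmt1 (R : Type*) [CommRing R] [IsLocalRing R]
    (A B : Type*) [AddCommGroup A] [Module R A] [AddCommGroup B] [Module R B]
    [Module.Free R A] [Module.Finite R A] [Module.Free R B] [Module.Finite R B]
    (f : A →ₗ[R] B) (g : B →ₗ[R] A)
    (fbar : (A ⧸ (IsLocalRing.maximalIdeal R • ⊤ : Submodule R A)) →ₗ[R]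
            (B ⧸ (IsLocalRing.maximalIdeal R • ⊤ : Submodule R B)))
    (hfbar : ∀ a : A, fbar (Submodule.Quotient.mk a) = Submodule.Quotient.mk (f a))
    (gbar : (B ⧸ (IsLocalRing.maximalIdeal R • ⊤ : Submodule R B)) →ₗ[R]
            (A ⧸ (IsLocalRing.maximalIdeal R • ⊤ : Submodule R A)))
    (hgbar : ∀ b : B, gbar (Submodule.Quotient.mk b) = Submodule.Quotient.mk (g b))
    (hsurj : Function.Surjective fbar)
    (hinj : Function.Injective gbar)
    (hnil : IsNilpotent (fbar ∘ₗ gbar :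
      Module.End R (B ⧸ (IsLocalRing.maximalIdeal R • ⊤ : Submodule R B)))) :
    (Subsingleton A ∧ Subsingleton B) ∨ Module.finrank R B < Module.finrank R A := by
  have hJ : IsLocalRing.maximalIdeal R ≤ Ideal.jacobson ⊥ :=
    (IsLocalRing.jacobson_eq_maximalIdeal ⊥ bot_ne_top).ge
  have hf : Function.Surjective f := by
    rw [← LinearMap.range_eq_top, eq_top_iff]
    refine Submodule.le_of_le_smul_of_le_jacobson_bot
      (I := IsLocalRing.maximalIdeal R) Module.Finite.fg_top hJ ?_
    intro b _
    obtain ⟨x, hx⟩ := hsurj (Submodule.Quotient.mk b)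
    obtain ⟨a, rfl⟩ := Submodule.Quotient.mk_surjective _ x
    rw [hfbar, eq_comm, Submodule.Quotient.eq] at hx
    have h := Submodule.add_mem_sup (LinearMap.mem_range_self f a) hx
    simpa using h
  have hle : Module.finrank R B ≤ Module.finrank R A :=
    LinearMap.finrank_le_finrank_of_surjective hf
  rcases hle.lt_or_eq with h | h
  · exact Or.inr h
  left
  have e : B ≃ₗ[R] A := LinearEquiv.ofFinrankEq B A h
  have hfi : Function.Injective f := by
    have h1 : Function.Injective (f ∘ₗ e.toLinearMap) :=
      OrzechProperty.injective_of_surjective_endomorphism _ (by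
        simpa using hf.comp e.surjective)
    intro x y hxy
    have := @h1 (e.symm x) (e.symm y) (by simpa using hxy)
    exact e.symm.injective this
  have hfb : Function.Injective fbar := by
    rw [injective_iff_map_eq_zero]
    intro x hx
    obtain ⟨a, rfl⟩ := Submodule.Quotient.mk_surjective _ x
    rw [hfbar, Submodule.Quotient.mk_eq_zero] at hx
    rw [Submodule.Quotient.mk_eq_zero]
    have hm : Submodule.map f (IsLocalRing.maximalIdeal R • ⊤ : Submodule R A)
        = IsLocalRing.maximalIdeal R • ⊤ := by
      rw [Submodule.map_smul'', Submodule.map_top, LinearMap.range_eq_top.mpr hf]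
    rw [← hm] at hx
    obtain ⟨a', ha', h'⟩ := hx
    rwa [← hfi h']
  obtain ⟨n, hn⟩ := hnil
  have hinjn : Function.Injective ((fbar ∘ₗ gbar :
      Module.End R (B ⧸ (IsLocalRing.maximalIdeal R • ⊤ : Submodule R B))) ^ n) := by
    rw [Module.End.coe_pow]
    exact (hfb.comp hinj).iterate n
  rw [hn] at hinjn
  have htop : (⊤ : Submodule R B) = ⊥ := by
    refine Submodule.eq_bot_of_le_smul_of_le_jacobson_bot
      (IsLocalRing.maximalIdeal R) _ Module.Finite.fg_top ?_ hJ
    intro b _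
    rw [← Submodule.Quotient.mk_eq_zero]
    exact hinjn (by simp)
  have hB : Subsingleton B := by
    rw [← Submodule.subsingleton_iff R]
    exact subsingleton_of_bot_eq_top htop.symm
  exact ⟨e.symm.toEquiv.subsingleton, hB⟩
end

section
/- Let Λ be a field, n ≥ 1, Q ⊆ {1, …, n−1}, A = Λ[[u_1, …, u_n]], and S = A[v_i : i ∈ Q]/(u_i·v_i : i ∈ Q), graded by ℤ^Q so that elements of A have degree 0 and v_i has degree the standard basis vector e_i. Let M = ⊕_{λ ∈ ℤ^Q} M_λ be a ℤ^Q-graded S-module satisfying: (1) M_λ = 0 unless λ ∈ ℕ^Q; (2) for every λ ∈ ℕ^Q, writing P = {i ∈ Q : λ_i ≥ 1} and 𝟙_P = Σ_{i∈P} e_i, multiplication by ∏_{i∈P} v_i^{λ_i − 1} is a bijection from M_{𝟙_P} onto M_λ; (3) for every P ⊆ Q and every i ∈ P, u_i·M_{𝟙_P} = 0. Then the natural map of graded S-modules M_0 ⊗_A S → M, m ⊗ s ↦ s·m, is an isomorphism if and only if for every P ⊆ Q and every j ∈ P, multiplication by v_j induces an isomorphism M_{𝟙_{P∖{j}}} /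 u_j·M_{𝟙_{P∖{j}}} → M_{𝟙_P}. -/
set_option synthInstance.maxHeartbeats 1000000
set_option maxHeartbeats 1000000

noncomputable section

open scoped TensorProduct

/-- `A = Λ[[u_1, …, u_n]]`, the formal power series ring in `n` variables over `Λ`. -/
abbrev PSA (Λ : Type) [Field Λ] (n : ℕ) : Type := MvPowerSeries (Fin n) Λ

/-- The ideal of relations `(u_i · v_i : i ∈ Q)` in the polynomial ring `A[v_i : i ∈ Q]`. -/
def rels (Λ : Type) [Field Λ] (n : ℕ) (Q : Finset (Fin n)) :
    Ideal (MvPolynomial {i : Fin n // i ∈ Q} (PSA Λ n)) :=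
  Ideal.span (Set.range fun i : {i : Fin n // i ∈ Q} =>
    MvPolynomial.C (MvPowerSeries.X (i : Fin n)) * MvPolynomial.X i)

/-- `S = A[v_i : i ∈ Q]/(u_i · v_i : i ∈ Q)`. -/
abbrev SRing (Λ : Type) [Field Λ] (n : ℕ) (Q : Finset (Fin n)) : Type :=
  MvPolynomial {i : Fin n // i ∈ Q} (PSA Λ n) ⧸ rels Λ n Q

/-- The image `u_i` of the power series variable `u_i` in `S`. -/
def uElt (Λ : Type) [Field Λ] (n : ℕ) (Q : Finset (Fin n)) (i : Fin n) : SRing Λ n Q :=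
  Ideal.Quotient.mk (rels Λ n Q) (MvPolynomial.C (MvPowerSeries.X i))

/-- The image `v_i` of the polynomial variable `v_i` in `S`. -/
def vElt (Λ : Type) [Field Λ] (n : ℕ) (Q : Finset (Fin n)) (i : {i : Fin n // i ∈ Q}) :
    SRing Λ n Q :=
  Ideal.Quotient.mk (rels Λ n Q) (MvPolynomial.X i)

/-- The indicator coweight `𝟙_P ∈ ℤ^Q` of a subset `P ⊆ Q`. -/
def indic {n : ℕ} {Q : Finset (Fin n)}
    (P : Finset {i : Fin n // i ∈ Q}) : {i : Fin n // i ∈ Q} → ℤ :=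
  fun i => if i ∈ P then 1 else 0

set_option linter.unusedSectionVars false

section Gen

/-- The submodule `∑_{i ∈ P} u_i N`. -/
def genJ {A I : Type} [CommRing A] (u : I → A) (N : Type) [AddCommGroup N] [Module A N]
    (P : Finset I) : Submodule A N :=
  ⨆ i ∈ P, LinearMap.range (LinearMap.lsmul A N (u i))

variable {A S M I : Type} [CommRing A] [CommRing S] [Algebra A S] [AddCommGroup M]
  [Module A M] [Module S M] [IsScalarTower A S M] [Fintype I] [DecidableEq I]

theorem genJ_mem (u : I → A) (N : Type) [AddCommGroup N] [Module A N] (P : Finset I)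
    (i : I) (hi : i ∈ P) (x : N) : u i • x ∈ genJ u N P := by
  have : LinearMap.range (LinearMap.lsmul A N (u i)) ≤ genJ u N P :=
    le_iSup₂_of_le i hi le_rfl
  exact this ⟨x, rfl⟩

theorem genJ_le (u : I → A) (N : Type) [AddCommGroup N] [Module A N] (P : Finset I)
    (K : Submodule A N) (h : ∀ i ∈ P, ∀ x : N, u i • x ∈ K) : genJ u N P ≤ K := by
  refine iSup₂_le fun i hi => ?_
  rintro _ ⟨x, rfl⟩
  exact h i hi x

theorem genJ_insert (u : I → A) (N : Type) [AddCommGroup N] [Module A N] (P : Finset I)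
    (j : I) (n : N) :
    n ∈ genJ u N (insert j P) ↔ ∃ b : N, n - u j • b ∈ genJ u N P := by
  unfold genJ
  rw [Finset.iSup_insert, Submodule.mem_sup]
  constructor
  · rintro ⟨_, ⟨b, rfl⟩, z, hz, rfl⟩
    exact ⟨b, by simpa using hz⟩
  · rintro ⟨b, hb⟩
    exact ⟨_, ⟨b, rfl⟩, _, hb, by simp⟩

theorem gen_kernel (u : I → A) (q : MvPolynomial I A →ₐ[A] S) (hq : Function.Surjective q)
    (hker : ∀ p, q p = 0 →
      p ∈ Ideal.span (Set.range fun i : I => MvPolynomial.C (u i) * MvPolynomial.X i))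
    (N : Type) [AddCommGroup N] [Module A N] (l : I →₀ ℕ) (n : N)
    (h : q (MvPolynomial.monomial l 1) ⊗ₜ[A] n = 0) : n ∈ genJ u N l.support := by
  let c : MvPolynomial I A →ₗ[A] N →ₗ[A] (N ⧸ genJ u N l.support) :=
    ((LinearMap.lsmul A N).compr₂ (genJ u N l.support).mkQ) ∘ₗ MvPolynomial.lcoeff A l
  have hc : ∀ p n, c p n = (genJ u N l.support).mkQ (MvPolynomial.coeff l p • n) :=
    fun p n => rfl
  have hk : LinearMap.ker q.toLinearMap ≤ LinearMap.ker c := by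
    intro p hp
    have hp' := hker p (by simpa using hp)
    rw [Ideal.span, Submodule.mem_span_range_iff_exists_fun] at hp'
    obtain ⟨a, rfl⟩ := hp'
    rw [LinearMap.mem_ker, map_sum]
    refine Finset.sum_eq_zero fun i _ => ?_
    ext x
    rw [hc]
    simp only [LinearMap.zero_apply, Submodule.mkQ_apply, Submodule.Quotient.mk_eq_zero]
    rw [smul_eq_mul, mul_left_comm, MvPolynomial.coeff_C_mul, MvPolynomial.coeff_mul_X']
    split_ifs with hi
    · rw [mul_smul]
      exact genJ_mem u N _ i hi _
    · simp
  let e := q.toLinearMap.quotKerEquivOfSurjective hq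
  let c' : S →ₗ[A] N →ₗ[A] (N ⧸ genJ u N l.support) :=
    ((LinearMap.ker q.toLinearMap).liftQ c hk) ∘ₗ e.symm.toLinearMap
  have hc' : ∀ p, c' (q p) = c p := by
    intro p
    have : e.symm (q p) = Submodule.Quotient.mk p := by
      rw [LinearEquiv.symm_apply_eq]; rfl
    simp only [c', LinearMap.comp_apply, LinearEquiv.coe_coe, this]
    rfl
  have h2 := congrArg (TensorProduct.lift c') h
  rw [TensorProduct.lift.tmul, hc', hc, map_zero] at h2
  simpa using h2

theorem gen_decomp (q : MvPolynomial I A →ₐ[A] S) (hq : Function.Surjective q)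
    (N : Type) [AddCommGroup N] [Module A N] (x : S ⊗[A] N) :
    ∃ f : (I →₀ ℕ) →₀ N, x = f.sum fun l n => q (MvPolynomial.monomial l 1) ⊗ₜ[A] n := by
  classical
  have hadd : ∀ f g : (I →₀ ℕ) →₀ N,
      (f + g).sum (fun l n => q (MvPolynomial.monomial l 1) ⊗ₜ[A] n) =
      f.sum (fun l n => q (MvPolynomial.monomial l 1) ⊗ₜ[A] n) +
      g.sum (fun l n => q (MvPolynomial.monomial l 1) ⊗ₜ[A] n) := fun f g =>
    Finsupp.sum_add_index' (fun _ => TensorProduct.tmul_zero _ _)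
      (fun _ _ _ => TensorProduct.tmul_add _ _ _)
  induction x using TensorProduct.induction_on with
  | zero => exact ⟨0, by simp⟩
  | add x y hx hy =>
    obtain ⟨f, rfl⟩ := hx
    obtain ⟨g, rfl⟩ := hy
    exact ⟨f + g, (hadd f g).symm⟩
  | tmul s n =>
    obtain ⟨p, rfl⟩ := hq s
    induction p using MvPolynomial.induction_on' with
    | monomial l a =>
      refine ⟨Finsupp.single l (a • n), ?_⟩
      rw [Finsupp.sum_single_index (by simp), TensorProduct.tmul_smul,
        TensorProduct.smul_tmul', ← map_smul, MvPolynomial.smul_monomial, smul_eq_mul, mul_one]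
    | add p p' hp hp' =>
      obtain ⟨f, hf⟩ := hp
      obtain ⟨g, hg⟩ := hp'
      exact ⟨f + g, by rw [hadd, map_add, TensorProduct.add_tmul, hf, hg]⟩

theorem gen_proj (ℳ : (I → ℤ) → Submodule A M) (hdirect : DirectSum.IsInternal ℳ)
    (mu : I → ℤ) : ∃ π : M →ₗ[A] M, (∀ x ∈ ℳ mu, π x = x) ∧
      ∀ nu, nu ≠ mu → ∀ x ∈ ℳ nu, π x = 0 := by
  let e := LinearEquiv.ofBijective (DirectSum.coeLinearMap ℳ) hdirect
  have he : ∀ nu (x : ℳ nu), e.symm (x : M) = DirectSum.lof A (I → ℤ) (fun i => ℳ i) nu x := by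
    intro nu x
    rw [LinearEquiv.symm_apply_eq]
    exact (DirectSum.coeLinearMap_lof ℳ nu x).symm
  refine ⟨(ℳ mu).subtype ∘ₗ DirectSum.component A (I → ℤ) (fun i => ℳ i) mu ∘ₗ
    e.symm.toLinearMap, ?_, ?_⟩
  · intro x hx
    have := he mu ⟨x, hx⟩
    simp only at this
    simp [this, DirectSum.component.lof_self]
  · intro nu hnu x hx
    have := he nu ⟨x, hx⟩
    simp only at this
    simp [this, DirectSum.component.of, hnu]

/-- integer weight of an exponent -/
def wt (l : I →₀ ℕ) : I → ℤ := fun i => (l i : ℤ)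

theorem wt_inj (l m : I →₀ ℕ) (h : wt l = wt m) : l = m := by
  ext i
  have := congrFun h i
  simpa [wt] using this

theorem gen_mem (q : MvPolynomial I A →ₐ[A] S) (ℳ : (I → ℤ) → Submodule A M)
    (hgraded : ∀ (lam : I → ℤ) (i : I) (m : M),
      m ∈ ℳ lam → q (MvPolynomial.X i) • m ∈ ℳ (fun j => lam j + if j = i then 1 else 0))
    (l : I →₀ ℕ) : ∀ (lam : I → ℤ) (m : M), m ∈ ℳ lam →
      q (MvPolynomial.monomial l 1) • m ∈ ℳ (lam + wt l) := by
  induction l using Finsupp.induction_linear with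
  | zero =>
    intro lam m hm
    have : lam + wt (0 : I →₀ ℕ) = lam := by ext; simp [wt]
    rw [this]
    have h1 : (MvPolynomial.monomial (0 : I →₀ ℕ) (1 : A)) = 1 := rfl
    rw [h1, map_one, one_smul]; exact hm
  | add f g hf hg =>
    intro lam m hm
    have h1 : (MvPolynomial.monomial (f + g) (1 : A)) =
      MvPolynomial.monomial g 1 * MvPolynomial.monomial f 1 := by
      rw [MvPolynomial.monomial_mul, one_mul, add_comm]
    have h2 : lam + wt (f + g) = (lam + wt f) + wt g := by
      ext i; simp [wt, add_assoc]
    rw [h1, map_mul, mul_smul, h2]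
    exact hg _ _ (hf _ _ hm)
  | single i k =>
    intro lam m hm
    induction k with
    | zero =>
      have : lam + wt (Finsupp.single i 0) = lam := by ext; simp [wt]
      rw [this, Finsupp.single_zero]
      have h1 : (MvPolynomial.monomial (0 : I →₀ ℕ) (1 : A)) = 1 := rfl
      rw [h1, map_one, one_smul]; exact hm
    | succ k ih =>
      have h1 : (MvPolynomial.monomial (Finsupp.single i (k + 1)) (1 : A)) =
        MvPolynomial.X i * MvPolynomial.monomial (Finsupp.single i k) 1 := by
        rw [MvPolynomial.X, MvPolynomial.monomial_mul, one_mul, add_comm k, Finsupp.single_add]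
      rw [h1, map_mul, mul_smul]
      have := hgraded _ i _ ih
      convert this using 2
      ext j
      simp only [wt, Pi.add_apply, Finsupp.single_apply]
      by_cases hj : j = i
      · subst hj; simp [add_assoc]
      · simp [hj, Ne.symm hj]

/-- The graded criterion. -/
theorem gen_claim (u : I → A) (q : MvPolynomial I A →ₐ[A] S) (hq : Function.Surjective q)
    (hker : ∀ p, q p = 0 →
      p ∈ Ideal.span (Set.range fun i : I => MvPolynomial.C (u i) * MvPolynomial.X i))
    (huv : ∀ i, u i • q (MvPolynomial.X i) = 0)
    (ℳ : (I → ℤ) → Submodule A M) (hdirect : DirectSum.IsInternal ℳ)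
    (hgraded : ∀ (lam : I → ℤ) (i : I) (m : M),
      m ∈ ℳ lam → q (MvPolynomial.X i) • m ∈ ℳ (fun j => lam j + if j = i then 1 else 0))
    (h1 : ∀ lam : I → ℤ, ¬ (∀ i, 0 ≤ lam i) → ℳ lam = ⊥)
    (ψ : S ⊗[A] (ℳ (0 : I → ℤ)) →ₗ[S] M)
    (hψ : ∀ (s : S) (m : ℳ (0 : I → ℤ)), ψ (s ⊗ₜ[A] m) = s • (m : M)) :
    Function.Bijective ψ ↔ ∀ l : I →₀ ℕ,
      (∀ m ∈ ℳ (wt l), ∃ n : ℳ (0 : I → ℤ), q (MvPolynomial.monomial l 1) • (n : M) = m) ∧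
      (∀ n : ℳ (0 : I → ℤ), q (MvPolynomial.monomial l 1) • (n : M) = 0 →
        n ∈ genJ u (ℳ (0 : I → ℤ)) l.support) := by
  have hmem : ∀ (l : I →₀ ℕ) (n : ℳ (0 : I → ℤ)),
      q (MvPolynomial.monomial l 1) • (n : M) ∈ ℳ (wt l) := by
    intro l n
    have := gen_mem q ℳ hgraded l 0 n n.2
    rwa [zero_add] at this
  have hψs : ∀ f : (I →₀ ℕ) →₀ ℳ (0 : I → ℤ),
      ψ (f.sum fun l n => q (MvPolynomial.monomial l 1) ⊗ₜ[A] n) =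
      f.sum fun l n => q (MvPolynomial.monomial l 1) • (n : M) := by
    intro f
    rw [Finsupp.sum, map_sum]
    exact Finset.sum_congr rfl fun l _ => hψ _ _
  have hcomp : ∀ (f : (I →₀ ℕ) →₀ ℳ (0 : I → ℤ)) (l : I →₀ ℕ), ∀ m ∈ ℳ (wt l),
      (f.sum fun l n => q (MvPolynomial.monomial l 1) • (n : M)) = m →
      q (MvPolynomial.monomial l 1) • (f l : M) = m := by
    intro f l m hm hs
    obtain ⟨π, hπ1, hπ2⟩ := gen_proj ℳ hdirect (wt l)
    have h := congrArg π hs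
    rw [hπ1 m hm, Finsupp.sum, map_sum, Finset.sum_eq_single l] at h
    · rwa [hπ1 _ (hmem _ _)] at h
    · intro b _ hb
      exact hπ2 (wt b) (fun h => hb (wt_inj _ _ h)) _ (hmem _ _)
    · intro hl
      rw [Finsupp.notMem_support_iff.mp hl]; simp
  constructor
  · rintro ⟨hinj, hsurj⟩ l
    constructor
    · intro m hm
      obtain ⟨x, rfl⟩ := hsurj m
      obtain ⟨f, rfl⟩ := gen_decomp q hq _ x
      rw [hψs] at hm ⊢
      exact ⟨f l, hcomp f l _ hm rfl⟩
    · intro n hn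
      apply gen_kernel u q hq hker
      apply hinj
      rw [hψ, hn, map_zero]
  · intro H
    constructor
    · rw [injective_iff_map_eq_zero]
      intro x hx
      obtain ⟨f, rfl⟩ := gen_decomp q hq _ x
      rw [hψs] at hx
      refine Finset.sum_eq_zero fun l _ => ?_
      have hz := (H l).2 (f l) (hcomp f l 0 (zero_mem _) hx)
      have hle : genJ u (ℳ (0 : I → ℤ)) l.support ≤
          LinearMap.ker (TensorProduct.mk A S (ℳ (0 : I → ℤ)) (q (MvPolynomial.monomial l 1))) := by
        refine genJ_le _ _ _ _ fun i hi y => ?_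
        rw [LinearMap.mem_ker, TensorProduct.mk_apply, TensorProduct.tmul_smul,
          TensorProduct.smul_tmul']
        have hl : l = Finsupp.single i 1 + (l - Finsupp.single i 1) := by
          rw [add_tsub_cancel_of_le]
          rw [Finsupp.single_le_iff]
          have := Finsupp.mem_support_iff.mp hi
          omega
        have : (MvPolynomial.monomial l (1 : A)) =
            MvPolynomial.X i * MvPolynomial.monomial (l - Finsupp.single i 1) 1 := by
          rw [MvPolynomial.X, MvPolynomial.monomial_mul, one_mul, ← hl]
        rw [this, map_mul, ← smul_mul_assoc, huv, zero_mul, TensorProduct.zero_tmul]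
      exact hle hz
    · rw [← Set.range_eq_univ, Set.eq_univ_iff_forall]
      intro m
      have htop : (⊤ : Submodule A M) ≤ LinearMap.range (ψ.restrictScalars A) := by
        rw [← hdirect.submodule_iSup_eq_top]
        refine iSup_le fun lam => ?_
        by_cases hl : ∀ i, 0 ≤ lam i
        · intro m hm
          let l : I →₀ ℕ := Finsupp.equivFunOnFinite.symm fun i => (lam i).toNat
          have hw : wt l = lam := by
            ext i; simp [wt, l, hl i]
          rw [← hw] at hm
          obtain ⟨n, hn⟩ := (H l).1 m hm
          exact ⟨_, (hψ _ n).trans hn⟩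
        · rw [h1 lam hl]; exact bot_le
      exact htop (Submodule.mem_top : m ∈ ⊤)

/-- indicator exponent of a finite set -/
def pw (P : Finset I) : I →₀ ℕ := Finsupp.equivFunOnFinite.symm fun i => if i ∈ P then 1 else 0

theorem pw_apply (P : Finset I) (i : I) : pw P i = if i ∈ P then 1 else 0 := rfl

theorem pw_support (P : Finset I) : (pw P).support = P := by
  ext i; simp [pw_apply]

theorem wt_pw (P : Finset I) : wt (pw P) = fun i => if i ∈ P then (1 : ℤ) else 0 := by
  ext i; simp [wt, pw_apply]

theorem pw_erase (P : Finset I) (j : I) (hj : j ∈ P) :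
    (MvPolynomial.monomial (pw P) (1 : A)) =
      MvPolynomial.X j * MvPolynomial.monomial (pw (P.erase j)) 1 := by
  rw [MvPolynomial.X, MvPolynomial.monomial_mul, one_mul]
  congr 2
  ext i
  simp only [pw_apply, Finsupp.add_apply, Finsupp.single_apply, Finset.mem_erase]
  by_cases h : i = j
  · subst h; simp [hj]
  · simp [h, Ne.symm h]

theorem mon_prod (l : I →₀ ℕ) :
    (MvPolynomial.monomial l (1 : A)) = ∏ i, MvPolynomial.X i ^ l i := by
  rw [MvPolynomial.monomial_eq, MvPolynomial.C_1, one_mul]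
  exact Finsupp.prod_fintype _ _ (fun i => pow_zero _)

theorem mon_factor (q : MvPolynomial I A →ₐ[A] S) (l : I →₀ ℕ) :
    q (MvPolynomial.monomial l (1 : A)) =
      (∏ i ∈ Finset.univ.filter (fun i => 1 ≤ wt l i),
        q (MvPolynomial.X i) ^ (wt l i - 1).toNat) *
      q (MvPolynomial.monomial (pw (Finset.univ.filter (fun i => 1 ≤ wt l i))) 1) := by
  rw [mon_prod, mon_prod, map_prod, map_prod, Finset.prod_filter, ← Finset.prod_mul_distrib]
  refine Finset.prod_congr rfl fun i _ => ?_
  rw [map_pow, map_pow, pw_apply]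
  simp only [Finset.mem_filter, Finset.mem_univ, true_and]
  split_ifs with h
  · rw [← pow_add]
    congr 1
    simp only [wt] at h ⊢
    omega
  · simp only [wt] at h
    have : l i = 0 := by omega
    simp [this]

theorem gen_main (u : I → A) (q : MvPolynomial I A →ₐ[A] S)
    (huv : ∀ i, u i • q (MvPolynomial.X i) = 0)
    (ℳ : (I → ℤ) → Submodule A M)
    (hgraded : ∀ (lam : I → ℤ) (i : I) (m : M),
      m ∈ ℳ lam → q (MvPolynomial.X i) • m ∈ ℳ (fun j => lam j + if j = i then 1 else 0))
    (h2 : ∀ lam : I → ℤ, (∀ i, 0 ≤ lam i) →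
      Set.BijOn
        (fun m => (∏ i ∈ Finset.univ.filter (fun i => 1 ≤ lam i),
            q (MvPolynomial.X i) ^ (lam i - 1).toNat) • m)
        (ℳ (wt (pw (Finset.univ.filter (fun i => 1 ≤ lam i)))) : Set M)
        (ℳ lam : Set M)) :
    (∀ l : I →₀ ℕ,
      (∀ m ∈ ℳ (wt l), ∃ n : ℳ (0 : I → ℤ), q (MvPolynomial.monomial l 1) • (n : M) = m) ∧
      (∀ n : ℳ (0 : I → ℤ), q (MvPolynomial.monomial l 1) • (n : M) = 0 →
        n ∈ genJ u (ℳ (0 : I → ℤ)) l.support)) ↔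
    ∀ (P : Finset I) (j : I), j ∈ P →
        ((∀ m' ∈ ℳ (wt (pw P)), ∃ m ∈ ℳ (wt (pw (P.erase j))), q (MvPolynomial.X j) • m = m') ∧
          (∀ m ∈ ℳ (wt (pw (P.erase j))), q (MvPolynomial.X j) • m = 0 →
            ∃ m' ∈ ℳ (wt (pw (P.erase j))), m = u j • m')) := by
  have hmem : ∀ (l : I →₀ ℕ) (n : ℳ (0 : I → ℤ)),
      q (MvPolynomial.monomial l 1) • (n : M) ∈ ℳ (wt l) := by
    intro l n
    have := gen_mem q ℳ hgraded l 0 n n.2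
    rwa [zero_add] at this
  have hcomm : ∀ (a : A) (s : S) (x : M), s • (a • x) = a • (s • x) := by
    intro a s x
    rw [← algebraMap_smul S a x, ← algebraMap_smul S a (s • x), smul_comm]
  -- elements of `J_P` are killed by `v^P`
  have hkill : ∀ (P : Finset I) (n : ℳ (0 : I → ℤ)), n ∈ genJ u (ℳ (0 : I → ℤ)) P →
      q (MvPolynomial.monomial (pw P) 1) • (n : M) = 0 := by
    intro P n hn
    let K : Submodule A (ℳ (0 : I → ℤ)) :=
      { carrier := {x | q (MvPolynomial.monomial (pw P) 1) • (x : M) = 0}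
        zero_mem' := by simp
        add_mem' := by
          intro a b ha hb
          simp only [Set.mem_ofPred_eq] at ha hb ⊢
          rw [Submodule.coe_add, smul_add, ha, hb, add_zero]
        smul_mem' := by
          intro c x hx
          simp only [Set.mem_ofPred_eq] at hx ⊢
          rw [Submodule.coe_smul, hcomm, hx, smul_zero] }
    refine genJ_le u _ P K (fun i hi x => ?_) hn
    change q (MvPolynomial.monomial (pw P) 1) • ((u i • x : ℳ (0 : I → ℤ)) : M) = 0
    rw [Submodule.coe_smul, hcomm, pw_erase P i hi, map_mul, mul_smul, ← smul_assoc, huv,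
      zero_smul]
  constructor
  · intro H P j hj
    constructor
    · intro m' hm'
      obtain ⟨n, rfl⟩ := (H (pw P)).1 m' hm'
      exact ⟨_, hmem (pw (P.erase j)) n, by rw [pw_erase P j hj, map_mul, mul_smul]⟩
    · intro m hm h0
      obtain ⟨n, rfl⟩ := (H (pw (P.erase j))).1 m hm
      have hn := (H (pw P)).2 n (by rw [pw_erase P j hj, map_mul, mul_smul, h0])
      rw [pw_support, ← Finset.insert_erase hj, genJ_insert] at hn
      obtain ⟨b, hb⟩ := hn
      refine ⟨_, hmem _ b, ?_⟩
      have := hkill _ _ hb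
      rw [Submodule.coe_sub, smul_sub, sub_eq_zero, Submodule.coe_smul, hcomm] at this
      exact this
  · intro H
    have key : ∀ P : Finset I,
      (∀ m ∈ ℳ (wt (pw P)), ∃ n : ℳ (0 : I → ℤ),
        q (MvPolynomial.monomial (pw P) 1) • (n : M) = m) ∧
      (∀ n : ℳ (0 : I → ℤ), q (MvPolynomial.monomial (pw P) 1) • (n : M) = 0 →
        n ∈ genJ u (ℳ (0 : I → ℤ)) P) := by
      intro P
      induction P using Finset.induction_on with
      | empty =>
        have h0 : pw (∅ : Finset I) = 0 := by ext i; simp [pw_apply]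
        have hw : wt (0 : I →₀ ℕ) = 0 := by ext i; simp [wt]
        have hone : (MvPolynomial.monomial (0 : I →₀ ℕ) (1 : A)) = 1 := rfl
        rw [h0, hw, hone, map_one]
        refine ⟨fun m hm => ⟨⟨m, hm⟩, one_smul _ _⟩, fun n hn => ?_⟩
        rw [one_smul] at hn
        have : n = 0 := Subtype.ext hn
        rw [this]; exact zero_mem _
      | insert j P hj ih =>
        have hjP := Finset.mem_insert_self j P
        have HP := H (insert j P) j hjP
        have hfac := pw_erase (A := A) (insert j P) j hjP
        rw [Finset.erase_insert hj] at HP hfac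
        rw [hfac, map_mul]
        constructor
        · intro m hm
          obtain ⟨m', hm', rfl⟩ := HP.1 m hm
          obtain ⟨n, rfl⟩ := ih.1 m' hm'
          exact ⟨n, mul_smul _ _ _⟩
        · intro n hn
          rw [mul_smul] at hn
          obtain ⟨m', hm', hEq⟩ := HP.2 _ (hmem _ n) hn
          obtain ⟨b, rfl⟩ := ih.1 m' hm'
          rw [genJ_insert]
          refine ⟨b, ih.2 _ ?_⟩
          rw [Submodule.coe_sub, smul_sub, sub_eq_zero, Submodule.coe_smul, hcomm]
          exact hEq
    intro l
    have hb := h2 (wt l) (fun i => by simp [wt])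
    have hfac := mon_factor q l
    have hsupp : Finset.univ.filter (fun i => 1 ≤ wt l i) = l.support := by
      refine Finset.ext fun i => ?_
      rw [Finset.mem_filter, Finsupp.mem_support_iff]
      simp only [Finset.mem_univ, true_and, wt]
      omega
    rw [hsupp] at hb hfac
    rw [hfac]
    constructor
    · intro m hm
      obtain ⟨m', hm', rfl⟩ := hb.surjOn hm
      obtain ⟨n, rfl⟩ := (key _).1 m' hm'
      exact ⟨n, mul_smul _ _ _⟩
    · intro n hn
      rw [mul_smul] at hn
      refine (key _).2 n ?_
      exact hb.injOn (hmem _ n) (zero_mem _) (by simpa using hn)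

end Gen

/-- Lemma 5.9 ('lemma-detect-gen') of the paper: for a `ℤ^Q`-graded `S`-module
`M = ⊕_λ M_λ` satisfying the three conditions of Corollary 5.4, the natural map
`M_0 ⊗_A S → M` is an isomorphism if and only if for every `P ⊆ Q` and every `j ∈ P`,
multiplication by `v_j` induces an isomorphism
`M_{𝟙_{P∖{j}}}/u_j·M_{𝟙_{P∖{j}}} → M_{𝟙_P}`. -/
theorem stmt3 (Λ : Type) [Field Λ] (n : ℕ) (hn : 1 ≤ n) (Q : Finset (Fin n))
    (hQ : ∀ i ∈ Q, (i : ℕ) + 1 < n)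
    (M : Type) [AddCommGroup M] [Module (SRing Λ n Q) M] [Module (PSA Λ n) M]
    [IsScalarTower (PSA Λ n) (SRing Λ n Q) M]
    -- the `ℤ^Q`-grading of `M`
    (ℳ : ({i : Fin n // i ∈ Q} → ℤ) → Submodule (PSA Λ n) M)
    (hdirect : DirectSum.IsInternal ℳ)
    (hgraded : ∀ (lam : {i : Fin n // i ∈ Q} → ℤ) (i : {i : Fin n // i ∈ Q}) (m : M),
      m ∈ ℳ lam → vElt Λ n Q i • m ∈ ℳ (fun j => lam j + if j = i then 1 else 0))
    -- condition (1): `M_λ = 0` unless `λ ∈ ℕ^Q`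
    (h1 : ∀ lam : {i : Fin n // i ∈ Q} → ℤ, ¬ (∀ i, 0 ≤ lam i) → ℳ lam = ⊥)
    -- condition (2): for `λ ∈ ℕ^Q` and `P = {i : λ_i ≥ 1}`, multiplication by
    -- `∏_{i ∈ P} v_i^{λ_i − 1}` is a bijection from `M_{𝟙_P}` onto `M_λ`
    (h2 : ∀ lam : {i : Fin n // i ∈ Q} → ℤ, (∀ i, 0 ≤ lam i) →
      Set.BijOn
        (fun m => (∏ i ∈ Finset.univ.filter (fun i => 1 ≤ lam i),
            vElt Λ n Q i ^ (lam i - 1).toNat) • m)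
        (ℳ (indic (Finset.univ.filter (fun i => 1 ≤ lam i))) : Set M)
        (ℳ lam : Set M))
    -- condition (3): `u_i · M_{𝟙_P} = 0` for every `P ⊆ Q` and `i ∈ P`
    (h3 : ∀ (P : Finset {i : Fin n // i ∈ Q}) (i : {i : Fin n // i ∈ Q}), i ∈ P →
      ∀ m ∈ ℳ (indic P), uElt Λ n Q (i : Fin n) • m = 0)
    -- the natural map `M_0 ⊗_A S → M`, `m ⊗ s ↦ s·m`
    (ψ : (SRing Λ n Q) ⊗[PSA Λ n] (ℳ (0 : {i : Fin n // i ∈ Q} → ℤ)) →ₗ[SRing Λ n Q] M)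
    (hψ : ∀ (s : SRing Λ n Q) (m : ℳ (0 : {i : Fin n // i ∈ Q} → ℤ)),
      ψ (s ⊗ₜ[PSA Λ n] m) = s • (m : M)) :
    Function.Bijective ψ ↔
      ∀ (P : Finset {i : Fin n // i ∈ Q}) (j : {i : Fin n // i ∈ Q}), j ∈ P →
        -- multiplication by `v_j` is surjective from `M_{𝟙_{P∖{j}}}` onto `M_{𝟙_P}` …
        ((∀ m' ∈ ℳ (indic P), ∃ m ∈ ℳ (indic (P.erase j)), vElt Λ n Q j • m = m') ∧
        -- … and its kernel on `M_{𝟙_{P∖{j}}}` is exactly `u_j · M_{𝟙_{P∖{j}}}`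
          (∀ m ∈ ℳ (indic (P.erase j)), vElt Λ n Q j • m = 0 →
            ∃ m' ∈ ℳ (indic (P.erase j)), m = uElt Λ n Q (j : Fin n) • m')) := by
  have hu : ∀ (i : Fin n) (m : M), uElt Λ n Q i • m = (MvPowerSeries.X i : PSA Λ n) • m :=
    fun i m => algebraMap_smul (SRing Λ n Q) (MvPowerSeries.X i : PSA Λ n) m
  have hind : ∀ P : Finset {i : Fin n // i ∈ Q}, indic P = wt (pw P) :=
    fun P => (wt_pw P).symm
  obtain ⟨q, hmk⟩ : ∃ q : MvPolynomial {i : Fin n // i ∈ Q} (PSA Λ n) →ₐ[PSA Λ n] SRing Λ n Q,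
      ∀ p, q p = Ideal.Quotient.mk (rels Λ n Q) p :=
    ⟨Ideal.Quotient.mkₐ (PSA Λ n) (rels Λ n Q), fun p => rfl⟩
  have hv : ∀ i, vElt Λ n Q i = q (MvPolynomial.X i) := fun i => (hmk _).symm
  have hqs : Function.Surjective q := by
    intro s
    obtain ⟨p, hp⟩ := Ideal.Quotient.mk_surjective s
    exact ⟨p, (hmk p).trans hp⟩
  have hker : ∀ p, q p = 0 → p ∈ Ideal.span (Set.range fun i : {i : Fin n // i ∈ Q} =>
      MvPolynomial.C (MvPowerSeries.X (i : Fin n) : PSA Λ n) * MvPolynomial.X i) := by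
    intro p hp
    rw [hmk, Ideal.Quotient.eq_zero_iff_mem] at hp
    exact hp
  have huv : ∀ i : {i : Fin n // i ∈ Q}, (MvPowerSeries.X (i : Fin n) : PSA Λ n) •
      q (MvPolynomial.X i) = 0 := by
    intro i
    rw [← map_smul, MvPolynomial.smul_eq_C_mul, hmk, Ideal.Quotient.eq_zero_iff_mem]
    exact Ideal.subset_span ⟨i, rfl⟩
  simp only [hind, hv] at h2 hgraded ⊢
  simp only [hu]
  have C1 := gen_claim (A := PSA Λ n) (S := SRing Λ n Q) (M := M) (I := {i : Fin n // i ∈ Q})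
    (fun i : {i : Fin n // i ∈ Q} => (MvPowerSeries.X (i : Fin n) : PSA Λ n))
    q hqs hker huv ℳ
  have C2 := gen_main (A := PSA Λ n) (S := SRing Λ n Q) (M := M) (I := {i : Fin n // i ∈ Q})
    (fun i : {i : Fin n // i ∈ Q} => (MvPowerSeries.X (i : Fin n) : PSA Λ n))
    q huv ℳ hgraded h2
  have C3 := C1 hdirect hgraded h1
  have C4 := C3 ψ hψ
  exact C4.trans C2
end
end
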